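/- arXiv:2406.04713 — 3 statements merged into one kernel-verified Lean document; each statement's English description precedes it below -/
import Mathlib

section
/- Let G be a group acting on ℝ^d such that every g ∈ G acts as a measurable bijection preserving Lebesgue measure, let q : ℝ^d → [0,∞) be a G-invariant probability density with associated measure μ_q = q·Leb, and let p be any probability measure on ℝ^d. Let ψ : ℝ^d × ℝ^d → ℝ^d be measurable such that for every x_0 ∈ ℝ^d the map x_1 ↦ ψ(x_0, x_1) preserves Lebesgue measure and satisfies ψ(x_0, x_1) ∈ G·x_1 for all x_1. Then the pushforward of the product measure p ⊗ μ_q under (x_0, x_1) ↦ ψ(x_0, x_1) equals μ_q. -/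
open MeasureTheory
open scoped ENNReal NNReal

/-- A measure-preserving map that leaves a density invariant preserves the weighted measure. -/
theorem MeasureTheory.MeasurePreserving.withDensity_of_comp_eq {α : Type*} [MeasurableSpace α]
    {μ : Measure α} {f : α → α} (hf : MeasurePreserving f μ μ) {h : α → ℝ≥0∞}
    (hh : Measurable h) (hinv : ∀ x, h (f x) = h x) :
    MeasurePreserving f (μ.withDensity h) (μ.withDensity h) := by
  refine ⟨hf.measurable, Measure.ext fun s hs => ?_⟩
  rw [Measure.map_apply hf.measurable hs, withDensity_apply _ (hf.measurable hs),
    withDensity_apply _ hs, ← hf.setLIntegral_comp_preimage hs hh]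
  simp only [hinv]

/-- If every section of `φ` maps `ν` to `ρ`, then `φ` maps `μ.prod ν` to `ρ` for every
probability measure `μ`. -/
theorem MeasureTheory.Measure.map_prod_eq_of_forall_measurePreserving {α β γ : Type*}
    [MeasurableSpace α] [MeasurableSpace β] [MeasurableSpace γ] {μ : Measure α}
    [IsProbabilityMeasure μ] {ν : Measure β} [SFinite ν] {ρ : Measure γ} {φ : α → β → γ}
    (hφ : Measurable fun z : α × β => φ z.1 z.2) (h : ∀ x, MeasurePreserving (φ x) ν ρ) :
    (μ.prod ν).map (fun z => φ z.1 z.2) = ρ := by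
  ext s hs
  rw [Measure.map_apply hφ hs, Measure.prod_apply (hφ hs)]
  have key (x : α) : ν (Prod.mk x ⁻¹' ((fun z : α × β => φ z.1 z.2) ⁻¹' s)) = ρ s :=
    (h x).measure_preimage hs.nullMeasurableSet
  simp [key]

/-- Theorem A.2: if for each base point `x₀` the time-1 conditional flow `x₁ ↦ ψ x₀ x₁`
preserves Lebesgue measure and lands in the `G`-orbit of `x₁`, and `q` is a `G`-invariant
probability density with measure `μ_q = q · Leb`, then for any probability measure `p` on the
base, the pushforward of `p ⊗ μ_q` under `(x₀, x₁) ↦ ψ x₀ x₁` equals `μ_q`. -/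
theorem flow_marginal_eq_target {d : ℕ} (G : Type*) [Group G] [MulAction G (Fin d → ℝ)]
    (hmeas : ∀ g : G, Measurable (fun x : Fin d → ℝ => g • x))
    (hpres : ∀ g : G, MeasurePreserving (fun x : Fin d → ℝ => g • x) volume volume)
    (q : (Fin d → ℝ) → NNReal) (hq : Measurable q)
    (hqinv : ∀ (g : G) (y : Fin d → ℝ), q (g • y) = q y)
    (hqprob : IsProbabilityMeasure (volume.withDensity (fun x => (q x : ℝ≥0∞))))
    (p : Measure (Fin d → ℝ)) [IsProbabilityMeasure p]
    (ψ : (Fin d → ℝ) → (Fin d → ℝ) → (Fin d → ℝ))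
    (hψ : Measurable (fun z : (Fin d → ℝ) × (Fin d → ℝ) => ψ z.1 z.2))
    (hψpres : ∀ x₀ : Fin d → ℝ,
      MeasurePreserving (fun x₁ => ψ x₀ x₁) (volume : Measure (Fin d → ℝ)) volume)
    (hψorb : ∀ x₀ x₁ : Fin d → ℝ, ψ x₀ x₁ ∈ MulAction.orbit G x₁) :
    Measure.map (fun z : (Fin d → ℝ) × (Fin d → ℝ) => ψ z.1 z.2)
        (p.prod (volume.withDensity (fun x => (q x : ℝ≥0∞)))) =
      volume.withDensity (fun x => (q x : ℝ≥0∞)) := by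
  refine Measure.map_prod_eq_of_forall_measurePreserving hψ fun x₀ =>
    (hψpres x₀).withDensity_of_comp_eq hq.coe_nnreal_ennreal fun x₁ => ?_
  obtain ⟨g, hg⟩ := hψorb x₀ x₁
  simp only [← hg, hqinv]
end

section
/- Fix n ≥ 1 and f, f_1 ∈ [0,1)^n. Define, for each i, u_i := wrap(f_i − (f_1)_i) − (1/n)·Σ_{j=1}^n wrap(f_j − (f_1)_j). Then: (a) Σ_{i=1}^n u_i = 0 (the field is mean-free); and (b) for every τ ∈ ℝ, replacing f by (fract(f_i + τ))_i and f_1 by (fract((f_1)_i + τ))_i leaves every u_i unchanged, i.e., the translation-removed conditional vector field is invariant under simultaneous global translation of both configurations on the torus. -/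
/-- `wrap x` is the unique representative of `x` modulo 1 lying in `(-1/2, 1/2]`. -/
noncomputable def wrap (x : ℝ) : ℝ := x - Int.ceil (x - 1 / 2)

theorem wrap_add_intCast (x : ℝ) (m : ℤ) : wrap (x + m) = wrap x := by
  have h : x + m - 1 / 2 = x - 1 / 2 + m := by ring
  simp only [wrap, h, Int.ceil_add_intCast, Int.cast_add]
  ring

theorem wrap_fract_add_sub_fract_add (a b τ : ℝ) :
    wrap (Int.fract (a + τ) - Int.fract (b + τ)) = wrap (a - b) := by
  have h : Int.fract (a + τ) - Int.fract (b + τ) =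
      a - b + ((⌊b + τ⌋ - ⌊a + τ⌋ : ℤ) : ℝ) := by
    simp only [Int.fract, Int.cast_sub]
    ring
  rw [h, wrap_add_intCast]

/-- The translation-removed conditional vector field
`u i = wrap (f i - f₁ i) - (1/n) ∑ⱼ wrap (f j - f₁ j)` on the `n`-atom flat torus is
(a) mean-free, and (b) invariant under simultaneous global translation
`f ↦ fract (f + τ)` of both configurations. -/
theorem mean_free_field_translation_invariant (n : ℕ) (hn : 1 ≤ n)
    (f f₁ : Fin n → ℝ) (hf : ∀ i, f i ∈ Set.Ico (0 : ℝ) 1)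
    (hf₁ : ∀ i, f₁ i ∈ Set.Ico (0 : ℝ) 1) :
    (∑ i, (wrap (f i - f₁ i) - (1 / (n : ℝ)) * ∑ j, wrap (f j - f₁ j)) = 0) ∧
    ∀ τ : ℝ, ∀ i,
      wrap (Int.fract (f i + τ) - Int.fract (f₁ i + τ)) -
          (1 / (n : ℝ)) * ∑ j, wrap (Int.fract (f j + τ) - Int.fract (f₁ j + τ)) =
        wrap (f i - f₁ i) - (1 / (n : ℝ)) * ∑ j, wrap (f j - f₁ j) := by
  have hn' : (n : ℝ) ≠ 0 := by positivity
  refine ⟨?_, fun τ i => by simp only [wrap_fract_add_sub_fract_add]⟩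
  rw [Finset.sum_sub_distrib, Finset.sum_const, Finset.card_univ, Fintype.card_fin, nsmul_eq_mul]
  field_simp
  ring
end

section
/- Let v : ℝ × ℝ^d → ℝ^d be continuous and uniformly Lipschitz in its second argument: there is K ≥ 0 with ‖v(t, x) − v(t, y)‖ ≤ K·‖x − y‖ for all t ∈ [0,1] and x, y ∈ ℝ^d. Let A : ℝ^d → ℝ^d be a continuous linear map satisfying v(t, A x) = A(v(t, x)) for all t ∈ [0,1] and x ∈ ℝ^d. Suppose ψ, φ : [0,1] → ℝ^d are differentiable with ψ'(t) = v(t, ψ(t)) and φ'(t) = v(t, φ(t)) for all t ∈ [0,1], and φ(0) = A(ψ(0)). Then φ(t) = A(ψ(t)) for all t ∈ [0,1]. -/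
/-- A `G`-equivariant (time-dependent) Lipschitz vector field generates a `G`-equivariant
flow: if `A` is a continuous linear symmetry commuting with `v`, and `ψ, φ` solve
`ψ' = v(t, ψ)` on `[0,1]` with `φ 0 = A (ψ 0)`, then `φ t = A (ψ t)` on all of `[0,1]`. -/
theorem equivariant_vector_field_equivariant_flow {d : ℕ}
    (v : ℝ → (Fin d → ℝ) → (Fin d → ℝ))
    (hv : Continuous (fun p : ℝ × (Fin d → ℝ) => v p.1 p.2))
    (K : ℝ) (hK : 0 ≤ K)
    (hlip : ∀ t ∈ Set.Icc (0 : ℝ) 1, ∀ x y : Fin d → ℝ, ‖v t x - v t y‖ ≤ K * ‖x - y‖)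
    (A : (Fin d → ℝ) →L[ℝ] (Fin d → ℝ))
    (hA : ∀ t ∈ Set.Icc (0 : ℝ) 1, ∀ x : Fin d → ℝ, v t (A x) = A (v t x))
    (ψ φ : ℝ → (Fin d → ℝ))
    (hψ : ∀ t ∈ Set.Icc (0 : ℝ) 1, HasDerivAt ψ (v t (ψ t)) t)
    (hφ : ∀ t ∈ Set.Icc (0 : ℝ) 1, HasDerivAt φ (v t (φ t)) t)
    (h0 : φ 0 = A (ψ 0)) :
    ∀ t ∈ Set.Icc (0 : ℝ) 1, φ t = A (ψ t) := by
  have hAψ : ∀ t ∈ Set.Icc (0 : ℝ) 1, HasDerivAt (fun s => A (ψ s)) (v t (A (ψ t))) t := by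
    intro t ht
    rw [hA t ht]
    exact A.hasFDerivAt.comp_hasDerivAt t (hψ t ht)
  exact ODE_solution_unique_of_mem_Icc_right (v := v) (K := K.toNNReal) (s := fun _ => Set.univ)
    (fun t ht => (LipschitzWith.of_dist_le_mul fun x y => by
      simpa only [dist_eq_norm, Real.coe_toNNReal K hK] using
        hlip t (Set.Ico_subset_Icc_self ht) x y).lipschitzOnWith)
    (HasDerivAt.continuousOn hφ)
    (fun t ht => (hφ t (Set.Ico_subset_Icc_self ht)).hasDerivWithinAt)
    (fun _ _ => Set.mem_univ _)
    (HasDerivAt.continuousOn hAψ)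
    (fun t ht => (hAψ t (Set.Ico_subset_Icc_self ht)).hasDerivWithinAt)
    (fun _ _ => Set.mem_univ _) h0
end
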